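/- For any digraph D, the hat number of the directed union D → K₂ satisfies h(D → K₂) ≤ max{ h(D), 1/2 + (1/4)·h(D) }. -/

import Mathlib

namespace HatProblem

variable {V : Type*} [Fintype V] [DecidableEq V]

/-- A team strategy: each vertex maps a full configuration to a guess (`none` = pass),
depending only on the colors of its out-neighbors. -/
def IsStrategy (A : V → V → Prop) (S : V → (V → Bool) → Option Bool) : Prop :=
  ∀ (v : V) (c c' : V → Bool), (∀ u, A v u → c u = c' u) → S v c = S v c'

/-- The team wins at configuration `c`: someone guesses correctly, nobody guesses wrong. -/
def Wins (S : V → (V → Bool) → Option Bool) (c : V → Bool) : Prop :=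
  (∃ v, S v c = some (c v)) ∧ ∀ v b, S v c = some b → b = c v

/-- The chance of success of a strategy. -/
noncomputable def chance (S : V → (V → Bool) → Option Bool) : ℚ :=
  ({c : V → Bool | Wins S c}.ncard : ℚ) / 2 ^ Fintype.card V

/-- The hat number of a digraph: the maximal chance of success over all strategies. -/
noncomputable def hatNumber (A : V → V → Prop) : ℚ :=
  haveI : Fintype {S : V → (V → Bool) → Option Bool // IsStrategy A S} :=
    Fintype.ofFinite _
  Finset.sup' (Finset.univ : Finset {S : V → (V → Bool) → Option Bool // IsStrategy A S})
    ⟨⟨fun _ _ => none, fun _ _ _ _ => rfl⟩, Finset.mem_univ _⟩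
    fun S => chance S.1

/-- A clique in the skeleton of a digraph: vertices pairwise joined by arcs both ways. -/
def IsDiClique (A : V → V → Prop) (s : Finset V) : Prop :=
  ∀ x ∈ s, ∀ y ∈ s, x ≠ y → A x y ∧ A y x

/-- The clique number of a digraph: the clique number of its skeleton. -/
noncomputable def cliqueNum (A : V → V → Prop) : ℕ :=
  sSup {n | ∃ s : Finset V, IsDiClique A s ∧ s.card = n}

/-- The directed union `C → D` of two digraphs. -/
def dUnion {W : Type*} (A : V → V → Prop) (B : W → W → Prop) :
    V ⊕ W → V ⊕ W → Prop
  | Sum.inl x, Sum.inl y => A x y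
  | Sum.inl _, Sum.inr _ => True
  | Sum.inr _, Sum.inl _ => False
  | Sum.inr x, Sum.inr y => B x y

/-- The complete digraph on `m` vertices. -/
def completeArc (m : ℕ) : Fin m → Fin m → Prop := fun a b => a ≠ b

end HatProblem

namespace HatProblem

section HatNumber

variable {V : Type*} [Fintype V]

lemma chance_le_hatNumber {A : V → V → Prop} {S : V → (V → Bool) → Option Bool}
    (hS : IsStrategy A S) : chance S ≤ hatNumber A := by
  let _ : Fintype {S : V → (V → Bool) → Option Bool // IsStrategy A S} := Fintype.ofFinite _
  exact Finset.le_sup' (fun S : {S // IsStrategy A S} => chance S.1)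
    (Finset.mem_univ (⟨S, hS⟩ : {S // IsStrategy A S}))

lemma hatNumber_le {A : V → V → Prop} {r : ℚ}
    (h : ∀ S : V → (V → Bool) → Option Bool, IsStrategy A S → chance S ≤ r) :
    hatNumber A ≤ r :=
  Finset.sup'_le _ _ fun S _ => h S.1 S.2

/-- Any set of configurations has density at most one. -/
lemma ncard_div_two_pow_le_one [DecidableEq V] (s : Set (V → Bool)) :
    (s.ncard : ℚ) / 2 ^ Fintype.card V ≤ 1 := by
  rw [div_le_one (by positivity)]
  have h : s.ncard ≤ Nat.card (V → Bool) := Set.ncard_le_card s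
  rw [Nat.card_eq_fintype_card, Fintype.card_fun, Fintype.card_bool] at h
  exact_mod_cast h

end HatNumber

section DUnion

variable {V W : Type*} [Fintype V]

/-- The chance of success of a strategy on a directed union, conditioned on the configuration `k`
of the second digraph. -/
noncomputable def condChance (S : V ⊕ W → (V ⊕ W → Bool) → Option Bool) (k : W → Bool) : ℚ :=
  ({c : V → Bool | Wins S (Sum.elim c k)}.ncard : ℚ) / 2 ^ Fintype.card V

lemma chance_eq_sum_condChance [DecidableEq V] [Fintype W] [DecidableEq W]
    (S : V ⊕ W → (V ⊕ W → Bool) → Option Bool) :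
    chance S = (∑ k, condChance S k) / 2 ^ Fintype.card W := by
  classical
  have h : {c : V ⊕ W → Bool | Wins S c}.ncard =
      ∑ k : W → Bool, {c : V → Bool | Wins S (Sum.elim c k)}.ncard := by
    simp only [Set.ncard_eq_toFinset_card', Set.toFinset_ofPred, Finset.card_filter]
    rw [← Fintype.sum_prod_type_right', ← (Equiv.sumArrowEquivProdArrow V W Bool).symm.sum_comp]
    rfl
  simp only [chance, condChance, h, ← Finset.sum_div, Fintype.card_sum, pow_add, div_div]
  push_cast
  rfl

/-- If a vertex of the second digraph guesses wrong whenever that digraph has configuration `k`,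
then the team never wins there. -/
lemma condChance_eq_zero {S : V ⊕ W → (V ⊕ W → Bool) → Option Bool} {k : W → Bool} {w : W}
    (h : ∀ c, S (Sum.inr w) (Sum.elim c k) = some (!k w)) : condChance S k = 0 := by
  have hempty : {c : V → Bool | Wins S (Sum.elim c k)} = ∅ := by
    ext c
    simp only [Set.mem_ofPred_eq, Set.mem_empty_iff_false, iff_false]
    intro hc
    simpa using hc.2 _ _ (h c)
  simp [condChance, hempty]

/-- If the second digraph passes at `k`, the first one has to win on its own. -/
lemma condChance_le_hatNumber [Fintype W] {A : V → V → Prop} {B : W → W → Prop}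
    {S : V ⊕ W → (V ⊕ W → Bool) → Option Bool} (hS : IsStrategy (dUnion A B) S) {k : W → Bool}
    (h : ∀ w c, S (Sum.inr w) (Sum.elim c k) = none) : condChance S k ≤ hatNumber A := by
  refine le_trans ?_ (chance_le_hatNumber (A := A)
    (S := fun v c => S (Sum.inl v) (Sum.elim c k)) fun v c c' hc => hS _ _ _ ?_)
  · unfold condChance chance
    gcongr
    · exact Set.toFinite _
    · rintro ⟨⟨v, hv⟩, hwrong⟩
      refine ⟨?_, fun u b => hwrong (Sum.inl u) b⟩
      cases v with
      | inl v => exact ⟨v, hv⟩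
      | inr w => simp [h] at hv
  · rintro (u | u) hu
    · exact hc u hu
    · rfl

end DUnion

/-- The optimization over the guesses `f`, `g` of the two vertices of `K₂`: here `p x y` is the
chance of success given that these vertices have colors `x` and `y`. -/
lemma mean_le_max_of_guesses (f g : Bool → Option Bool) (p : Bool → Bool → ℚ) (r : ℚ)
    (hr₀ : 0 ≤ r) (hr₁ : r ≤ 1) (hf : ∀ x y, f y = some (!x) → p x y = 0)
    (hg : ∀ x y, g x = some (!y) → p x y = 0)
    (h_pass : ∀ x y, g x = none → f y = none → p x y ≤ r) (h_one : ∀ x y, p x y ≤ 1) :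
    (p true true + p true false + (p false true + p false false)) / 4 ≤
      max r (1 / 2 + (1 / 4) * r) := by
  rw [le_max_iff]
  simp only [Bool.forall_bool, Bool.not_true, Bool.not_false] at hf hg h_pass h_one
  generalize p true true = p₁, p true false = p₂, p false true = p₃, p false false = p₄,
    f true = f₁, f false = f₂, g true = g₁, g false = g₂ at *
  rcases f₁ with _ | _ | _ <;> rcases f₂ with _ | _ | _ <;>
    rcases g₁ with _ | _ | _ <;> rcases g₂ with _ | _ | _ <;> grind

/-- For any digraph `D` we have `h(D → K₂) ≤ max {h(D), 1/2 + (1/4)·h(D)}`. -/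
theorem hatNumber_dUnion_K2_le {V : Type*} [Fintype V] [DecidableEq V]
    (A : V → V → Prop) (hA : Irreflexive A) :
    hatNumber (dUnion A (completeArc 2)) ≤
      max (hatNumber A) (1 / 2 + (1 / 4) * hatNumber A) := by
  refine hatNumber_le fun S hS => ?_
  obtain ⟨f, hf⟩ : ∃ f : Bool → Option Bool,
      ∀ c x y, S (Sum.inr 0) (Sum.elim c ![x, y]) = f y := by
    refine ⟨fun y => S (Sum.inr 0) fun _ => y, fun c x y => hS _ _ _ ?_⟩
    rintro (u | u) hu
    · exact hu.elim
    · fin_cases u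
      · exact (hu rfl).elim
      · rfl
  obtain ⟨g, hg⟩ : ∃ g : Bool → Option Bool,
      ∀ c x y, S (Sum.inr 1) (Sum.elim c ![x, y]) = g x := by
    refine ⟨fun x => S (Sum.inr 1) fun _ => x, fun c x y => hS _ _ _ ?_⟩
    rintro (u | u) hu
    · exact hu.elim
    · fin_cases u
      · rfl
      · exact (hu rfl).elim
  have hf_wrong (x y) (h : f y = some (!x)) : condChance S ![x, y] = 0 :=
    condChance_eq_zero (w := 0) fun c => (hf c x y).trans h
  have hg_wrong (x y) (h : g x = some (!y)) : condChance S ![x, y] = 0 :=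
    condChance_eq_zero (w := 1) fun c => (hg c x y).trans h
  have h_pass (x y) (hx : g x = none) (hy : f y = none) :
      condChance S ![x, y] ≤ hatNumber A := by
    refine condChance_le_hatNumber hS fun w c => ?_
    fin_cases w
    · exact (hf c x y).trans hy
    · exact (hg c x y).trans hx
  have h_one (x y) : condChance S ![x, y] ≤ 1 := ncard_div_two_pow_le_one _
  have h_sum : chance S = (condChance S ![true, true] + condChance S ![true, false] +
      (condChance S ![false, true] + condChance S ![false, false])) / 4 := by
    rw [chance_eq_sum_condChance, ← (finTwoArrowEquiv Bool).symm.sum_comp,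
      Fintype.sum_prod_type]
    norm_num [finTwoArrowEquiv]
  have h_hat_nonneg : 0 ≤ hatNumber A :=
    le_trans (by unfold chance; positivity)
      (chance_le_hatNumber (S := fun _ _ => none) fun _ _ _ _ => rfl)
  have h_hat_le : hatNumber A ≤ 1 := hatNumber_le fun _ _ => ncard_div_two_pow_le_one _
  rw [h_sum]
  exact mean_le_max_of_guesses f g (fun x y => condChance S ![x, y]) (hatNumber A)
    h_hat_nonneg h_hat_le hf_wrong hg_wrong h_pass h_one

end HatProblem
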